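/- Let (X, 𝒜, μ) be a finite measure space and let S : X × ℝ^{3×3}_sym → ℝ^{3×3}_sym satisfy: (i) S(·,K) is measurable for each K and S(x,·) is continuous for a.e. x; (ii) S(x,0) = 0 for a.e. x; (iii) monotonicity: (S(x,K₁) − S(x,K₂)):(K₁ − K₂) ≥ 0 for all K₁, K₂ and a.e. x; (iv) local boundedness: for every R > 0 there is C_R > 0 with |S(x,K)| ≤ C_R for a.e. x and all |K| ≤ R. Let D : X → ℝ^{3×3}_sym be measurable with D ∈ L¹(X; ℝ^{3×3}), and let S̄ ∈ L¹(X; ℝ^{3×3}_sym) be such that S̄ : D ∈ L¹(X). Assume that for every w ∈ L^∞(X; ℝ^{3×3}_sym), ∫_X (S(x, w(x)) − S̄(x)) : (w(x) − D(x)) dμ(x) ≥ 0. Then S̄(x) = S(x, D(x)) for a.e. x ∈ X. -/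

import Mathlib

open MeasureTheory Filter

noncomputable section

/-- The Frobenius inner product `A : B` of two `3 × 3` real matrices. -/
def frobInner (A B : Matrix (Fin 3) (Fin 3) ℝ) : ℝ :=
  ∑ i, ∑ j, A i j * B i j

/-- The Frobenius norm of a `3 × 3` real matrix. -/
def frobNorm (A : Matrix (Fin 3) (Fin 3) ℝ) : ℝ :=
  Real.sqrt (∑ i, ∑ j, (A i j) ^ 2)

lemma abs_apply_le_frobNorm (A : Matrix (Fin 3) (Fin 3) ℝ) (i j : Fin 3) :
    |A i j| ≤ frobNorm A := by
  refine Real.abs_le_sqrt ?_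
  calc (A i j) ^ 2 ≤ ∑ j', (A i j') ^ 2 :=
        Finset.single_le_sum (f := fun j' => (A i j') ^ 2)
          (fun _ _ => sq_nonneg _) (Finset.mem_univ j)
    _ ≤ ∑ i', ∑ j', (A i' j') ^ 2 :=
        Finset.single_le_sum (f := fun i' => ∑ j', (A i' j') ^ 2)
          (fun _ _ => Finset.sum_nonneg fun _ _ => sq_nonneg _) (Finset.mem_univ i)

lemma frobNorm_le_of_abs_apply_le {A : Matrix (Fin 3) (Fin 3) ℝ} {c : ℝ} (hc : 0 ≤ c)
    (h : ∀ i j, |A i j| ≤ c) : frobNorm A ≤ 3 * c := by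
  refine Real.sqrt_le_iff.mpr ⟨by positivity, ?_⟩
  calc ∑ i, ∑ j, (A i j) ^ 2 ≤ ∑ _i : Fin 3, ∑ _j : Fin 3, c ^ 2 :=
        Finset.sum_le_sum fun i _ => Finset.sum_le_sum fun j _ =>
          sq_le_sq' (abs_le.mp (h i j)).1 (abs_le.mp (h i j)).2
    _ = (3 * c) ^ 2 := by simp; ring

lemma frobInner_smul_right (c : ℝ) (A B : Matrix (Fin 3) (Fin 3) ℝ) :
    frobInner A (c • B) = c * frobInner A B := by
  simp only [frobInner, Matrix.smul_apply, smul_eq_mul, Finset.mul_sum]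
  exact Finset.sum_congr rfl fun i _ => Finset.sum_congr rfl fun j _ => by ring

lemma frobInner_neg_right (A B : Matrix (Fin 3) (Fin 3) ℝ) :
    frobInner A (-B) = -frobInner A B := by
  simp [frobInner]

lemma frobInner_neg_neg (A B : Matrix (Fin 3) (Fin 3) ℝ) :
    frobInner (-A) (-B) = frobInner A B := by
  simp [frobInner]

lemma frobInner_zero_right (A : Matrix (Fin 3) (Fin 3) ℝ) : frobInner A 0 = 0 := by
  simp [frobInner]

lemma frobInner_single (A : Matrix (Fin 3) (Fin 3) ℝ) (i j : Fin 3) :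
    frobInner A (Matrix.single i j 1 + Matrix.single j i 1) = A i j + A j i := by
  fin_cases i <;> fin_cases j <;> simp [frobInner, Fin.sum_univ_three, Matrix.single] <;> ring

lemma continuous_frobInner_left (B : Matrix (Fin 3) (Fin 3) ℝ) :
    Continuous fun A => frobInner A B := by
  unfold frobInner
  fun_prop

/-- A symmetric matrix that is Frobenius-nonnegative against all symmetric matrices vanishes. -/
lemma eq_zero_of_forall_frobInner_nonneg {G : Matrix (Fin 3) (Fin 3) ℝ} (hG : G.IsSymm)
    (h : ∀ i j, 0 ≤ frobInner G (Matrix.single i j 1 + Matrix.single j i 1))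
    (h' : ∀ i j, 0 ≤ frobInner G (-(Matrix.single i j 1 + Matrix.single j i 1))) : G = 0 := by
  ext i j
  have h1 := h i j
  have h2 := h' i j
  rw [frobInner_neg_right, frobInner_single] at h2
  rw [frobInner_single] at h1
  have h3 := hG.apply i j
  simp only [Matrix.zero_apply]
  linarith

lemma measurableSet_isSymm {X : Type*} [MeasurableSpace X]
    {D : X → Matrix (Fin 3) (Fin 3) ℝ} (hD : ∀ i j, Measurable fun x => D x i j) :
    MeasurableSet {x | (D x).IsSymm} := by
  have : {x | (D x).IsSymm} = ⋂ i, ⋂ j, {x | D x j i = D x i j} := by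
    ext x
    simp only [Set.mem_ofPred_eq, Set.mem_iInter]
    exact ⟨fun h i j => h.apply i j, fun h => Matrix.IsSymm.ext h⟩
  rw [this]
  exact MeasurableSet.iInter fun i => MeasurableSet.iInter fun j =>
    measurableSet_eq_fun (hD j i) (hD i j)

lemma measurable_frobNorm {X : Type*} [MeasurableSpace X]
    {D : X → Matrix (Fin 3) (Fin 3) ℝ} (hD : ∀ i j, Measurable fun x => D x i j) :
    Measurable fun x => frobNorm (D x) := by
  unfold frobNorm
  fun_prop

/-- Superposition of a Carathéodory map with a measurable map is a.e. measurable. -/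
lemma aemeasurable_caratheodory_comp {X : Type*} [MeasurableSpace X] {μ : Measure X}
    {S : X → Matrix (Fin 3) (Fin 3) ℝ → Matrix (Fin 3) (Fin 3) ℝ}
    (hSmeas : ∀ K i j, Measurable fun x => S x K i j)
    (hScont : ∀ᵐ x ∂μ, Continuous (S x))
    {w : X → Matrix (Fin 3) (Fin 3) ℝ} (hw : ∀ i j, Measurable fun x => w x i j) (i j : Fin 3) :
    AEMeasurable (fun x => S x (w x) i j) μ := by
  classical
  obtain ⟨N, hsub, hN, hN0⟩ := exists_measurable_superset_of_null (ae_iff.mp hScont)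
  let u : (Fin 3 → Fin 3 → ℝ) → X → ℝ := fun K => N.piecewise 0 fun x => S x (Matrix.of K) i j
  have hu_cont : ∀ x, Continuous fun K => u K x := by
    intro x
    by_cases hx : x ∈ N
    · simpa [u, hx] using continuous_const
    · have hc : Continuous (S x) := by
        by_contra h
        exact hx (hsub h)
      have : Continuous fun K : Matrix (Fin 3) (Fin 3) ℝ => S x K i j :=
        hc.matrix_elem i j
      simp only [u, Set.piecewise_eq_of_notMem _ _ _ hx]
      exact this
  have hu_meas : ∀ K, StronglyMeasurable (u K) := fun K =>
    (Measurable.piecewise hN measurable_const (hSmeas (Matrix.of K) i j)).stronglyMeasurable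
  have hunc := (stronglyMeasurable_uncurry_of_continuous_of_stronglyMeasurable
    hu_cont hu_meas).measurable
  have hw' : Measurable fun x => ((fun a b => w x a b : Fin 3 → Fin 3 → ℝ), x) :=
    (measurable_pi_lambda _ fun a => measurable_pi_lambda _ fun b => hw a b).prodMk measurable_id
  refine ⟨_, hunc.comp hw', ?_⟩
  have hNae : ∀ᵐ x ∂μ, x ∉ N := measure_eq_zero_iff_ae_notMem.mp hN0
  filter_upwards [hNae] with x hx
  simp only [Function.comp_apply, Function.uncurry, u, Set.piecewise_eq_of_notMem _ _ _ hx]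
  rfl

/-- Testing with truncations of `D` shifted by a constant symmetric matrix on a sublevel set of
`frobNorm D` localizes the integral inequality. -/
lemma minty_shifted_nonneg
    {X : Type*} [MeasurableSpace X] (μ : Measure X) [IsFiniteMeasure μ]
    (S : X → Matrix (Fin 3) (Fin 3) ℝ → Matrix (Fin 3) (Fin 3) ℝ)
    (hSmeas : ∀ K i j, Measurable fun x => S x K i j)
    (hScont : ∀ᵐ x ∂μ, Continuous (S x))
    (hS0 : ∀ᵐ x ∂μ, S x 0 = 0)
    (hloc : ∀ R > (0 : ℝ), ∃ C > (0 : ℝ), ∀ᵐ x ∂μ,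
      ∀ K : Matrix (Fin 3) (Fin 3) ℝ, frobNorm K ≤ R → frobNorm (S x K) ≤ C)
    (D : X → Matrix (Fin 3) (Fin 3) ℝ)
    (hDmeas : ∀ i j, Measurable fun x => D x i j)
    (hDsym : ∀ᵐ x ∂μ, (D x).IsSymm)
    (Sbar : X → Matrix (Fin 3) (Fin 3) ℝ)
    (hSbarmeas : ∀ i j, Measurable fun x => Sbar x i j)
    (hSbarint : Integrable (fun x => frobNorm (Sbar x)) μ)
    (hSbarDint : Integrable (fun x => frobInner (Sbar x) (D x)) μ)
    (hkey : ∀ w : X → Matrix (Fin 3) (Fin 3) ℝ,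
      (∀ i j, Measurable fun x => w x i j) →
      (∃ Cw : ℝ, ∀ x, frobNorm (w x) ≤ Cw) →
      (∀ x, (w x).IsSymm) →
      0 ≤ ∫ x, frobInner (S x (w x) - Sbar x) (w x - D x) ∂μ)
    (V : Matrix (Fin 3) (Fin 3) ℝ) (hV : V.IsSymm) :
    ∀ᵐ x ∂μ, 0 ≤ frobInner (S x (D x + V) - Sbar x) V := by
  classical
  let A : ℕ → Set X := fun k => {x | frobNorm (D x) ≤ k} ∩ {x | (D x).IsSymm}
  have hA : ∀ k, MeasurableSet (A k) := fun k =>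
    (measurableSet_le (measurable_frobNorm hDmeas) measurable_const).inter
      (measurableSet_isSymm hDmeas)
  have hAmono : Monotone A := fun k l hkl x hx =>
    ⟨show frobNorm (D x) ≤ l from le_trans hx.1 (Nat.cast_le.mpr hkl), hx.2⟩
  have hAae : ∀ᵐ x ∂μ, ∃ k, x ∈ A k := by
    filter_upwards [hDsym] with x hx
    obtain ⟨k, hk⟩ := exists_nat_ge (frobNorm (D x))
    exact ⟨k, hk, hx⟩
  have htail : Tendsto (fun j => ∫ x in (A j)ᶜ, frobInner (Sbar x) (D x) ∂μ) atTop (nhds 0) := by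
    have h := tendsto_setIntegral_of_antitone (μ := μ)
      (f := fun x => frobInner (Sbar x) (D x)) (fun j => (hA j).compl)
      (fun k l hkl => Set.compl_subset_compl.mpr (hAmono hkl)) ⟨0, hSbarDint.integrableOn⟩
    have h0 : μ (⋂ j, (A j)ᶜ) = 0 := by
      rw [measure_eq_zero_iff_ae_notMem]
      filter_upwards [hAae] with x hx
      simpa using hx
    rwa [setIntegral_measure_zero _ h0] at h
  let f : X → ℝ := fun x => frobInner (S x (D x + V) - Sbar x) V
  have hbound : ∀ k, ∀ x ∈ A k, frobNorm (D x + V) ≤ 3 * (k + frobNorm V) := by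
    intro k x hx
    refine frobNorm_le_of_abs_apply_le (add_nonneg k.cast_nonneg (Real.sqrt_nonneg _)) ?_
    intro i j
    exact (abs_add_le _ _).trans
      (add_le_add ((abs_apply_le_frobNorm _ i j).trans hx.1) (abs_apply_le_frobNorm V i j))
  have hDVmeas : ∀ i j, Measurable fun x => (D x + V) i j := fun i j =>
    (hDmeas i j).add_const _
  have hSbar_ij : ∀ i j, Integrable (fun x => Sbar x i j) μ := fun i j =>
    hSbarint.mono' (hSbarmeas i j).aestronglyMeasurable
      (Eventually.of_forall fun x => abs_apply_le_frobNorm (Sbar x) i j)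
  have hfint : ∀ k, Integrable f (μ.restrict (A k)) := by
    intro k
    obtain ⟨C, -, hC⟩ := hloc (3 * (k + frobNorm V) + 1) (by
      have := Real.sqrt_nonneg (∑ i, ∑ j, (V i j) ^ 2)
      unfold frobNorm
      positivity)
    have hS_ij : ∀ i j, Integrable (fun x => S x (D x + V) i j) (μ.restrict (A k)) := by
      intro i j
      refine Integrable.of_bound
        (aemeasurable_caratheodory_comp hSmeas hScont hDVmeas i j).restrict.aestronglyMeasurable
        C ?_
      filter_upwards [ae_restrict_of_ae hC, ae_restrict_mem (hA k)] with x hx hxA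
      exact (abs_apply_le_frobNorm _ i j).trans (hx _ ((hbound k x hxA).trans (by linarith)))
    exact integrable_finsetSum _ fun i _ => integrable_finsetSum _ fun j _ =>
      ((hS_ij i j).sub (hSbar_ij i j).restrict).mul_const _
  have hsplit : ∀ k, ∀ s, MeasurableSet s → s ⊆ A k → ∀ j, k ≤ j →
      0 ≤ (∫ x in s, f x ∂μ) + ∫ x in (A j)ᶜ, frobInner (Sbar x) (D x) ∂μ := by
    intro k s hs hsk j hkj
    have hsj : s ⊆ A j := hsk.trans (hAmono hkj)
    let w : X → Matrix (Fin 3) (Fin 3) ℝ := fun x =>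
      if x ∈ s then D x + V else if x ∈ A j then D x else 0
    have hw := hkey w
      (by
        intro a b
        have : (fun x => w x a b) = fun x =>
            if x ∈ s then (D x + V) a b else if x ∈ A j then D x a b else 0 := by
          ext x
          simp only [w]
          split_ifs <;> rfl
        rw [this]
        exact Measurable.ite hs (hDVmeas a b)
          (Measurable.ite (hA j) (hDmeas a b) measurable_const))
      ⟨3 * (j + frobNorm V), by
        intro x
        have hVn : 0 ≤ frobNorm V := Real.sqrt_nonneg _
        have hj : (0 : ℝ) ≤ j := j.cast_nonneg
        simp only [w]
        split_ifs with h1 h2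
        · exact hbound j x (hsj h1)
        · exact h2.1.trans (by linarith)
        · simp only [frobNorm, Matrix.zero_apply] at hVn ⊢
          simp
          positivity⟩
      (by
        intro x
        simp only [w]
        split_ifs with h1 h2
        · exact (hsj h1).2.add hV
        · exact h2.2
        · exact Matrix.isSymm_zero)
    have hae : (fun x => frobInner (S x (w x) - Sbar x) (w x - D x)) =ᵐ[μ]
        fun x => s.indicator f x +
          (A j)ᶜ.indicator (fun x => frobInner (Sbar x) (D x)) x := by
      filter_upwards [hS0] with x hx0
      by_cases h1 : x ∈ s
      · simp [w, h1, hsj h1, f]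
      · by_cases h2 : x ∈ A j
        · simp [w, h1, h2, frobInner_zero_right]
        · simp [w, h1, h2, hx0, frobInner_neg_neg]
    rw [integral_congr_ae hae, integral_add
      ((integrable_indicator_iff hs).mpr ((show IntegrableOn f (A k) μ from hfint k).mono_set hsk))
      (hSbarDint.indicator (hA j).compl), integral_indicator hs,
      integral_indicator (hA j).compl] at hw
    exact hw
  have hnonneg : ∀ k, ∀ᵐ x ∂μ, x ∈ A k → 0 ≤ f x := by
    intro k
    rw [← ae_restrict_iff' (hA k)]
    refine ae_nonneg_of_forall_setIntegral_nonneg (hfint k) fun s hs _ => ?_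
    rw [Measure.restrict_restrict hs]
    have hlim := htail.const_add (∫ x in s ∩ A k, f x ∂μ)
    rw [add_zero] at hlim
    exact ge_of_tendsto hlim (eventually_atTop.mpr
      ⟨k, hsplit k _ (hs.inter (hA k)) Set.inter_subset_right⟩)
  filter_upwards [ae_all_iff.mpr hnonneg, hAae] with x hx ⟨k, hk⟩
  exact hx k hk

/-- Letting the shift tend to zero along a fixed direction. -/
lemma frobInner_nonneg_of_shifted {T : Matrix (Fin 3) (Fin 3) ℝ → Matrix (Fin 3) (Fin 3) ℝ}
    (hT : Continuous T) (B K V : Matrix (Fin 3) (Fin 3) ℝ)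
    (h : ∀ n : ℕ, 0 ≤ frobInner (T (K + (1 / ((n : ℝ) + 1)) • V) - B)
      ((1 / ((n : ℝ) + 1)) • V)) :
    0 ≤ frobInner (T K - B) V := by
  have hc : Continuous fun t : ℝ => frobInner (T (K + t • V) - B) V :=
    (continuous_frobInner_left V).comp
      ((hT.comp (continuous_const.add (continuous_id.smul continuous_const))).sub
        continuous_const)
  have hlim := (hc.tendsto 0).comp (tendsto_one_div_add_atTop_nhds_zero_nat (𝕜 := ℝ))
  simp only [zero_smul, add_zero] at hlim
  refine ge_of_tendsto' hlim fun n => ?_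
  have hn := h n
  rw [frobInner_smul_right] at hn
  exact nonneg_of_mul_nonneg_right hn (by positivity)

/-- **generalized Minty monotonicity trick.** Let `S(x,K)` be a Carathéodory,
monotone, locally bounded tensor with `S(x,0) = 0`, taking symmetric values on symmetric
arguments. If `D ∈ L¹`, `S̄ ∈ L¹` with `S̄ : D ∈ L¹` and
`∫ (S(x,w) − S̄) : (w − D) dμ ≥ 0` for every essentially bounded symmetric-valued `w`,
then `S̄(x) = S(x, D(x))` a.e. -/
theorem minty_identification
    {X : Type*} [MeasurableSpace X] (μ : Measure X) [IsFiniteMeasure μ]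
    (S : X → Matrix (Fin 3) (Fin 3) ℝ → Matrix (Fin 3) (Fin 3) ℝ)
    (hSmeas : ∀ K i j, Measurable fun x => S x K i j)
    (hScont : ∀ᵐ x ∂μ, Continuous (S x))
    (hS0 : ∀ᵐ x ∂μ, S x 0 = 0)
    (hSsym : ∀ᵐ x ∂μ, ∀ K : Matrix (Fin 3) (Fin 3) ℝ, K.IsSymm → (S x K).IsSymm)
    (hmono : ∀ᵐ x ∂μ, ∀ K₁ K₂ : Matrix (Fin 3) (Fin 3) ℝ, K₁.IsSymm → K₂.IsSymm →
      0 ≤ frobInner (S x K₁ - S x K₂) (K₁ - K₂))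
    (hloc : ∀ R > (0 : ℝ), ∃ C > (0 : ℝ), ∀ᵐ x ∂μ,
      ∀ K : Matrix (Fin 3) (Fin 3) ℝ, frobNorm K ≤ R → frobNorm (S x K) ≤ C)
    (D : X → Matrix (Fin 3) (Fin 3) ℝ)
    (hDmeas : ∀ i j, Measurable fun x => D x i j)
    (hDsym : ∀ᵐ x ∂μ, (D x).IsSymm)
    (hDint : Integrable (fun x => frobNorm (D x)) μ)
    (Sbar : X → Matrix (Fin 3) (Fin 3) ℝ)
    (hSbarmeas : ∀ i j, Measurable fun x => Sbar x i j)
    (hSbarsym : ∀ᵐ x ∂μ, (Sbar x).IsSymm)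
    (hSbarint : Integrable (fun x => frobNorm (Sbar x)) μ)
    (hSbarDint : Integrable (fun x => frobInner (Sbar x) (D x)) μ)
    (hkey : ∀ w : X → Matrix (Fin 3) (Fin 3) ℝ,
      (∀ i j, Measurable fun x => w x i j) →
      (∃ Cw : ℝ, ∀ x, frobNorm (w x) ≤ Cw) →
      (∀ x, (w x).IsSymm) →
      0 ≤ ∫ x, frobInner (S x (w x) - Sbar x) (w x - D x) ∂μ) :
    ∀ᵐ x ∂μ, Sbar x = S x (D x) := by
  have hshift : ∀ V : Matrix (Fin 3) (Fin 3) ℝ, V.IsSymm →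
      ∀ᵐ x ∂μ, 0 ≤ frobInner (S x (D x) - Sbar x) V := by
    intro V hV
    have h : ∀ n : ℕ, ∀ᵐ x ∂μ, 0 ≤ frobInner (S x (D x + (1 / ((n : ℝ) + 1)) • V) - Sbar x)
        ((1 / ((n : ℝ) + 1)) • V) := fun n =>
      minty_shifted_nonneg μ S hSmeas hScont hS0 hloc D hDmeas hDsym Sbar hSbarmeas hSbarint
        hSbarDint hkey _ (hV.smul _)
    filter_upwards [ae_all_iff.mpr h, hScont] with x hx hc
    exact frobInner_nonneg_of_shifted hc _ _ _ hx
  have hbasis : ∀ i j : Fin 3,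
      (Matrix.single i j (1 : ℝ) + Matrix.single j i 1).IsSymm := fun i j => by
    simp [Matrix.IsSymm, Matrix.transpose_add, add_comm]
  have hpos := ae_all_iff.mpr fun i => ae_all_iff.mpr fun j => hshift _ (hbasis i j)
  have hneg := ae_all_iff.mpr fun i => ae_all_iff.mpr fun j => hshift _ (hbasis i j).neg
  filter_upwards [hpos, hneg, hSsym, hDsym, hSbarsym] with x h1 h2 hS hDx hB
  exact (sub_eq_zero.mp
    (eq_zero_of_forall_frobInner_nonneg ((hS _ hDx).sub hB) h1 h2)).symm
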